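/- arXiv:2605.02314 — 3 statements merged into one kernel-verified Lean document; each statement's English description precedes it below -/
import Mathlib

section
/- For every ℓ ∈ ℕ and n₀ ∈ ℕ there exists a family of edge-rooted finite simple graphs (F₁,(a₁,b₁)), …, (F_ℓ,(a_ℓ,b_ℓ)), with F_i having n_i ≥ n₀ vertices, such that: (1) each F_i is rigid; (2) for every i and every two distinct vertices u, v of F_i there exist common neighbors x, y, z of u and v with xy, xz, yz all edges of F_i; (3) for every i, N(a_i)∖N(b_i) ≠ ∅ ≠ N(b_i)∖N(a_i); (4) for every i, d(a_i) < d(b_i); (5) for all i < j, every vertex of F_i has strictly smaller degree than every vertex of F_j; (6) for all i, j, i', j' ∈ [ℓ] with the unordered pairs {i,j} ≠ {i',j'}, the set 𝒟_{i,j} of values d_{F_i}(u₁)+d_{F_i}(u₁')+d_{F_j}(v₁)+d_{F_j}(v₁'), d_{F_i}(u₁)+d_{F_i}(u₁')+d_{F_j}(v₁), and d_{F_i}(u₁)+d_{F_j}(v₁) over u₁, u₁' ∈ V(F_i), v₁, v₁' ∈ V(F_j) is disjoint from the analogously defined set 𝒟_{i',j'}; (7) the union over all i, j ∈ [ℓ]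 of the sets 𝒟_{i,j} is disjoint from the set of single degrees {d_{F_t}(w) : t ∈ [ℓ], w ∈ V(F_t)}; (8) for every i there exists S_i ⊆ V(F_i)∖{a_i,b_i} such that every vertex of S_i has strictly larger degree than every vertex outside S_i, all vertices of S_i have pairwise distinct degrees, and any two distinct vertices u, v ∈ V(F_i)∖S_i satisfy N(u)∩S_i ≠ N(v)∩S_i. -/
/-- A graph is rigid if the identity is its only graph homomorphism to itself. -/
def Rigid {V : Type} (G : SimpleGraph V) : Prop :=
  ∀ f : G →g G, ∀ x : V, f x = x

/-- The degree of a vertex (as the cardinality of its neighborhood). -/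
noncomputable def deg {V : Type} (G : SimpleGraph V) (v : V) : ℕ :=
  (G.neighborSet v).ncard

/-- The set `𝒟` of sums of degrees `d(u₁)+d(u₁')+d(v₁)+d(v₁')`, `d(u₁)+d(u₁')+d(v₁)`
and `d(u₁)+d(v₁)` with `u₁, u₁'` vertices of the first graph and `v₁, v₁'` vertices
of the second graph. -/
def DegSumSet {V W : Type} (G₁ : SimpleGraph V) (G₂ : SimpleGraph W) : Set ℕ :=
  {d | ∃ u₁ u₁' : V, ∃ v₁ v₁' : W,
      d = deg G₁ u₁ + deg G₁ u₁' + deg G₂ v₁ + deg G₂ v₁'} ∪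
  {d | ∃ u₁ u₁' : V, ∃ v₁ : W, d = deg G₁ u₁ + deg G₁ u₁' + deg G₂ v₁} ∪
  {d | ∃ u₁ : V, ∃ v₁ : W, d = deg G₁ u₁ + deg G₂ v₁}

theorem deg_eq_degree {n : ℕ} (G : SimpleGraph (Fin n)) [DecidableRel G.Adj] (v : Fin n) :
    deg G v = G.degree v := by
  rw [deg, Set.ncard_eq_toFinset_card', ← SimpleGraph.card_neighborFinset_eq_degree]
  rfl

theorem deg_compl_add_deg {n : ℕ} (G : SimpleGraph (Fin n)) (v : Fin n) :
    deg Gᶜ v + deg G v + 1 = n := by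
  classical
  have h := G.degree_compl v
  have h' := G.degree_lt_card_verts v
  rw [Fintype.card_fin] at h h'
  rw [deg_eq_degree, deg_eq_degree, h]
  omega

/-- The complement of a triangle-free graph on an odd Hamiltonian cycle is a core: it is
vertex-critical for its chromatic number. -/
theorem surjective_of_compl_hom {k : ℕ} (H : SimpleGraph (Fin (2 * k + 1)))
    (hcycle : ∀ x, H.Adj x (x + 1))
    (htri : ∀ x y z, H.Adj x y → H.Adj y z → ¬ H.Adj x z) (f : Hᶜ →g Hᶜ) :
    Function.Surjective f := by
  by_contra hf
  obtain ⟨v, hv⟩ := not_forall.1 hf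
  have hpos : ∀ x, 0 < (f x - v).val := fun x => by
    rw [Nat.pos_iff_ne_zero, ne_eq, Fin.val_eq_zero_iff, sub_eq_zero]
    exact fun h => hv ⟨x, h⟩
  have hadj : ∀ x y, x ≠ y → ((f x - v).val - 1) / 2 = ((f y - v).val - 1) / 2 →
      (f x - v).val ≤ (f y - v).val → H.Adj x y := by
    intro x y hxy h hle
    by_contra hn
    have hF : Hᶜ.Adj (f x) (f y) := f.map_rel ((H.compl_adj x y).2 ⟨hxy, hn⟩)
    rw [SimpleGraph.compl_adj] at hF
    have hx := hpos x
    have hy := hpos y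
    rcases eq_or_ne (f x - v).val (f y - v).val with he | hne
    · exact hF.1 (sub_left_injective (Fin.ext he))
    · have hlt := (f y - v).isLt
      have hs : f y - v = f x - v + 1 := by
        apply Fin.ext
        rw [Fin.val_add_one_of_lt']
        · omega
        · omega
      have hs' : f y = f x + 1 := by
        rw [sub_add_eq_add_sub] at hs
        exact sub_left_injective hs
      exact hF.2 (hs' ▸ hcycle (f x))
  have hadj' : ∀ x y, x ≠ y → ((f x - v).val - 1) / 2 = ((f y - v).val - 1) / 2 →
      H.Adj x y := fun x y hxy h =>
    (le_total (f x - v).val (f y - v).val).elim (hadj x y hxy h)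
      (fun hle => (hadj y x hxy.symm h.symm hle).symm)
  obtain ⟨c, -, hc⟩ := Finset.exists_lt_card_fiber_of_mul_lt_card_of_maps_to
    (s := (Finset.univ : Finset (Fin (2 * k + 1)))) (t := Finset.range k) (n := 2)
    (f := fun x => ((f x - v).val - 1) / 2)
    (fun x _ => by
      have h1 := hpos x
      have h2 := (f x - v).isLt
      rw [Finset.mem_range]
      omega)
    (by rw [Finset.card_range, Finset.card_univ, Fintype.card_fin]; omega)
  obtain ⟨x, hx, y, hy, z, hz, hxy, hxz, hyz⟩ := Finset.two_lt_card.1 hc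
  simp only [Finset.mem_filter, Finset.mem_univ, true_and] at hx hy hz
  exact htri x y z (hadj' x y hxy (hx.trans hy.symm)) (hadj' y z hyz (hy.trans hz.symm))
    (hadj' x z hxz (hx.trans hz.symm))

theorem deg_map_of_bijective {n : ℕ} (G : SimpleGraph (Fin n)) (f : G →g G)
    (hf : Function.Bijective f) (v : Fin n) : deg G (f v) = deg G v := by
  classical
  have hle : ∀ x, G.degree x ≤ G.degree (f x) := fun x => by
    rw [← SimpleGraph.card_neighborFinset_eq_degree, ← SimpleGraph.card_neighborFinset_eq_degree]
    refine Finset.card_le_card_of_injOn f (fun y hy => ?_) hf.1.injOn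
    rw [Finset.mem_coe, SimpleGraph.mem_neighborFinset] at *
    exact f.map_rel hy
  have hsum : ∑ x, G.degree x = ∑ x, G.degree (f x) :=
    ((Equiv.ofBijective f hf).sum_comp fun x => G.degree x).symm
  rw [deg_eq_degree, deg_eq_degree]
  exact ((Finset.sum_eq_sum_iff_of_le fun x _ => hle x).1 hsum v (Finset.mem_univ v)).symm

/-- A set of vertices of large, pairwise distinct degrees that separates the other vertices is
fixed pointwise by every bijective endomorphism, hence so is every vertex. -/
theorem rigid_of_separating {n : ℕ} (G : SimpleGraph (Fin n))
    (hsurj : ∀ f : G →g G, Function.Surjective f) (S : Set (Fin n))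
    (hlarge : ∀ u ∈ S, ∀ v ∉ S, deg G v < deg G u)
    (hdist : ∀ u ∈ S, ∀ v ∈ S, u ≠ v → deg G u ≠ deg G v)
    (hsep : ∀ u v : Fin n, u ∉ S → v ∉ S → u ≠ v →
      G.neighborSet u ∩ S ≠ G.neighborSet v ∩ S) : Rigid G := by
  intro f
  have hf : Function.Bijective f := Finite.surjective_iff_bijective.1 (hsurj f)
  have hdeg := deg_map_of_bijective G f hf
  have hS : ∀ u ∈ S, f u = u := by
    intro u hu
    have hfu : f u ∈ S := by
      by_contra h
      exact (hlarge u hu _ h).ne (hdeg u)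
    by_contra h
    exact hdist _ hfu _ hu h (hdeg u)
  have hmap : ∀ x, deg G x = (G.neighborSet (f x)).ncard := fun x => (hdeg x).symm
  have himage : ∀ x, f '' G.neighborSet x = G.neighborSet (f x) := by
    intro x
    refine Set.eq_of_subset_of_ncard_le ?_ ?_ (Set.toFinite _)
    · rintro _ ⟨y, hy, rfl⟩
      exact f.map_rel hy
    · rw [Set.ncard_image_of_injective _ hf.1]
      exact (hmap x).ge
  intro x
  by_cases hx : x ∈ S
  · exact hS x hx
  have hfx : f x ∉ S := fun h => hx (by rwa [hf.1 (hS _ h)] at h)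
  by_contra hne
  refine hsep _ _ hfx hx hne ?_
  ext s
  refine and_congr_left fun hs => ?_
  rw [← himage, ← hS s hs, hf.1.mem_set_image, hS s hs]

theorem exists_compl_adj_all {n d : ℕ} (H : SimpleGraph (Fin n))
    (hd : ∀ v, deg H v ≤ d) (X : Finset (Fin n)) (hX : X.card * (d + 1) < n) :
    ∃ z, ∀ x ∈ X, Hᶜ.Adj x z := by
  classical
  have hcard : (X.biUnion fun x => insert x (H.neighborFinset x)).card ≤ X.card * (d + 1) :=
    Finset.card_biUnion_le_card_mul _ _ _ fun x _ => (Finset.card_insert_le _ _).trans (by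
      rw [SimpleGraph.card_neighborFinset_eq_degree, ← deg_eq_degree]
      exact Nat.succ_le_succ (hd x))
  obtain ⟨z, hz⟩ : ∃ z, z ∉ X.biUnion fun x => insert x (H.neighborFinset x) := by
    by_contra! h
    rw [Finset.eq_univ_iff_forall.2 h, Finset.card_univ, Fintype.card_fin] at hcard
    omega
  refine ⟨z, fun x hx => ?_⟩
  simp only [Finset.mem_biUnion, Finset.mem_insert, SimpleGraph.mem_neighborFinset, not_exists,
    not_and, not_or] at hz
  exact (H.compl_adj x z).2 ⟨fun h => (hz x hx).1 h.symm, (hz x hx).2⟩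

theorem exists_common_triangle {n d : ℕ} (H : SimpleGraph (Fin n))
    (hd : ∀ v, deg H v ≤ d) (hn : 4 * (d + 1) < n) (u v : Fin n) :
    ∃ x y z : Fin n, Hᶜ.Adj u x ∧ Hᶜ.Adj v x ∧ Hᶜ.Adj u y ∧ Hᶜ.Adj v y ∧
      Hᶜ.Adj u z ∧ Hᶜ.Adj v z ∧ Hᶜ.Adj x y ∧ Hᶜ.Adj x z ∧ Hᶜ.Adj y z := by
  classical
  have key : ∀ X : Finset (Fin n), X.card ≤ 4 → ∃ z, ∀ x ∈ X, Hᶜ.Adj x z := fun X hX =>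
    exists_compl_adj_all H hd X ((Nat.mul_le_mul_right _ hX).trans_lt hn)
  obtain ⟨x, hx⟩ := key {u, v} (Finset.card_le_two.trans (by norm_num))
  obtain ⟨y, hy⟩ := key {u, v, x} (Finset.card_le_three.trans (by norm_num))
  obtain ⟨z, hz⟩ := key {u, v, x, y} Finset.card_le_four
  simp only [Finset.mem_insert, Finset.mem_singleton, forall_eq_or_imp, forall_eq] at hx hy hz
  exact ⟨x, y, z, hx.1, hx.2, hy.1, hy.2.1, hz.1, hz.2.1, hy.2.2, hz.2.2.1, hz.2.2.2⟩

theorem digit_nine (k : ℕ) : ∀ {a b : ℕ} (i j : ℕ), a ≤ 4 → b ≤ 4 →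
    (a * 9 ^ i + b * 9 ^ j) / 9 ^ k % 9 = (if i = k then a else 0) + (if j = k then b else 0) := by
  induction k with
  | zero =>
    intro a b i j ha hb
    rcases i with _ | i <;> rcases j with _ | j <;> simp [pow_succ, ← mul_assoc] <;>
      omega
  | succ k ih =>
    intro a b i j ha hb
    rw [pow_succ', ← Nat.div_div_eq_div_mul]
    rcases i with _ | i <;> rcases j with _ | j
    · have h : (a * 9 ^ 0 + b * 9 ^ 0) / 9 = 0 := by simp; omega
      rw [h]; simp
    · have h : (a * 9 ^ 0 + b * 9 ^ (j + 1)) / 9 = 0 * 9 ^ 0 + b * 9 ^ j := by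
        rw [pow_succ, ← mul_assoc]; omega
      rw [h, ih 0 j (by norm_num) hb]
      simp
    · have h : (a * 9 ^ (i + 1) + b * 9 ^ 0) / 9 = a * 9 ^ i + 0 * 9 ^ 0 := by
        rw [pow_succ, ← mul_assoc]; omega
      rw [h, ih i 0 ha (by norm_num)]
      simp
    · have h : (a * 9 ^ (i + 1) + b * 9 ^ (j + 1)) / 9 = a * 9 ^ i + b * 9 ^ j := by
        rw [pow_succ, pow_succ, ← mul_assoc, ← mul_assoc]; omega
      rw [h, ih i j ha hb]
      simp

theorem eq_of_mul_near {D s x m m' : ℕ} (hD : 8 * s < D) (h₁ : x ≤ m * D + 4 * s)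
    (h₂ : m * D ≤ x + 4 * s) (h₁' : x ≤ m' * D + 4 * s) (h₂' : m' * D ≤ x + 4 * s) :
    m = m' := by
  by_contra hne
  rcases Nat.lt_or_gt_of_ne hne with h | h <;>
  · have := Nat.mul_le_mul_right D (Nat.succ_le_of_lt h)
    rw [Nat.succ_mul] at this
    omega

theorem pow_sum_support {a b i j a' b' i' j' : ℕ} (ha : 1 ≤ a ∧ a ≤ 2) (hb : 1 ≤ b ∧ b ≤ 2)
    (ha' : 1 ≤ a' ∧ a' ≤ 2) (hb' : 1 ≤ b' ∧ b' ≤ 2)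
    (h : a * 9 ^ i + b * 9 ^ j = a' * 9 ^ i' + b' * 9 ^ j') (k : ℕ) :
    (k = i ∨ k = j) ↔ (k = i' ∨ k = j') := by
  have h1 := digit_nine k i j (a := a) (b := b) (by omega) (by omega)
  have h2 := digit_nine k i' j' (a := a') (b := b') (by omega) (by omega)
  rw [h, h2] at h1
  split_ifs at h1 <;> omega

theorem pow_sum_ne_pow {a b i j t : ℕ} (ha : 1 ≤ a ∧ a ≤ 2) (hb : 1 ≤ b ∧ b ≤ 2) :
    a * 9 ^ i + b * 9 ^ j ≠ 9 ^ t := by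
  intro h
  have key := fun k => digit_nine k i j (a := a) (b := b) (by omega) (by omega)
  have key' := fun k => digit_nine k t t (a := 1) (b := 0) (by omega) (by omega)
  simp only [one_mul, zero_mul, add_zero] at key'
  rw [h] at key
  have hi := (key i).symm.trans (key' i)
  have hj := (key j).symm.trans (key' j)
  split_ifs at hi hj <;> omega

/-- Sums of degrees from two nearly regular graphs are close to the corresponding integer
combinations of the approximate degrees. -/
theorem exists_near_of_mem_degSumSet {V W : Type} {G₁ : SimpleGraph V} {G₂ : SimpleGraph W}
    {D s p r x : ℕ} (h₁ : ∀ v, deg G₁ v ≤ p * D + s ∧ p * D ≤ deg G₁ v + s)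
    (h₂ : ∀ v, deg G₂ v ≤ r * D + s ∧ r * D ≤ deg G₂ v + s) (hx : x ∈ DegSumSet G₁ G₂) :
    ∃ a b : ℕ, (1 ≤ a ∧ a ≤ 2) ∧ (1 ≤ b ∧ b ≤ 2) ∧
      x ≤ (a * p + b * r) * D + 4 * s ∧ (a * p + b * r) * D ≤ x + 4 * s := by
  simp only [add_mul, mul_assoc]
  rcases hx with (⟨u, u', v, v', rfl⟩ | ⟨u, u', v, rfl⟩) | ⟨u, v, rfl⟩
  · have := h₁ u
    have := h₁ u'
    have := h₂ v
    have := h₂ v'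
    exact ⟨2, 2, by omega, by omega, by omega, by omega⟩
  · have := h₁ u
    have := h₁ u'
    have := h₂ v
    exact ⟨2, 1, by omega, by omega, by omega, by omega⟩
  · have := h₁ u
    have := h₂ v
    exact ⟨1, 1, by omega, by omega, by omega, by omega⟩

theorem deg_eq_card {n : ℕ} (H : SimpleGraph (Fin n)) (v : Fin n) (s : Finset ℕ)
    (h : ∀ y, y ∈ s ↔ ∃ hy : y < n, H.Adj v ⟨y, hy⟩) : deg H v = s.card := by
  rw [deg, ← Set.ncard_image_of_injective _ Fin.val_injective, ← Set.ncard_coe_finset]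
  congr 1
  ext y
  rw [Finset.mem_coe, h]
  constructor
  · rintro ⟨w, hw, rfl⟩
    exact ⟨w.isLt, hw⟩
  · rintro ⟨hy, hw⟩
    exact ⟨⟨y, hy⟩, hw, rfl⟩

theorem deg_le_card {n : ℕ} (H : SimpleGraph (Fin n)) (v : Fin n) (s : Finset ℕ)
    (h : ∀ w, H.Adj v w → w.val ∈ s) : deg H v ≤ s.card := by
  rw [deg, ← Set.ncard_image_of_injective _ Fin.val_injective, ← Set.ncard_coe_finset]
  refine Set.ncard_le_ncard ?_ (Finset.finite_toSet s)
  rintro _ ⟨w, hw, rfl⟩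
  exact h w hw

theorem card_le_deg {n : ℕ} (H : SimpleGraph (Fin n)) (v : Fin n) (s : Finset ℕ)
    (h : ∀ y ∈ s, ∃ hy : y < n, H.Adj v ⟨y, hy⟩) : s.card ≤ deg H v := by
  rw [deg, ← Set.ncard_image_of_injective _ Fin.val_injective, ← Set.ncard_coe_finset]
  refine Set.ncard_le_ncard ?_ (Set.toFinite _)
  intro y hy
  obtain ⟨hn, ha⟩ := h y hy
  exact ⟨⟨y, hn⟩, ha, rfl⟩

/-- The arithmetic progression of length `m` with first term `z` and difference `2`. -/
def stepTwo (z m : ℕ) : Finset ℕ := (Finset.range m).image fun k => z + 2 * k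

theorem mem_stepTwo {z m y : ℕ} : y ∈ stepTwo z m ↔ z ≤ y ∧ y < z + 2 * m ∧ y % 2 = z % 2 := by
  simp only [stepTwo, Finset.mem_image, Finset.mem_range]
  constructor
  · rintro ⟨k, hk, rfl⟩
    omega
  · rintro ⟨h1, h2, h3⟩
    exact ⟨(y - z) / 2, by omega, by omega⟩

theorem card_stepTwo (z m : ℕ) : (stepTwo z m).card = m := by
  rw [stepTwo, Finset.card_image_of_injective _ fun a b h => by simpa using h,
    Finset.card_range]

/-- Index `i < 2 * q` is hit by `g < q * q` if it is one of the two coordinates of `g`, the low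
indices standing for the first coordinate and the high ones for the second. -/
def CoordHit (q i g : ℕ) : Prop := g < q * q ∧ (i = g / q ∨ i = q + g % q)

theorem card_filter_coordHit {q i : ℕ} (hi : i < 2 * q) [DecidablePred (CoordHit q i)] :
    ((Finset.range (q * q)).filter (CoordHit q i)).card = q := by
  have hq : 0 < q := by omega
  by_cases h : i < q
  · have : (Finset.range (q * q)).filter (CoordHit q i) =
        (Finset.range q).image fun k => k + q * i := by
      ext g
      simp only [Finset.mem_filter, Finset.mem_range, CoordHit, Finset.mem_image]
      constructor
      · rintro ⟨-, hg, h' | h'⟩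
        · exact ⟨g % q, Nat.mod_lt _ hq, by rw [h', Nat.mod_add_div]⟩
        · omega
      · rintro ⟨k, hk, rfl⟩
        have hlt : k + q * i < q * q := by
          have := Nat.mul_le_mul_left q (Nat.succ_le_of_lt h)
          rw [Nat.mul_succ] at this
          omega
        refine ⟨hlt, hlt, Or.inl ?_⟩
        rw [Nat.add_mul_div_left _ _ hq, Nat.div_eq_of_lt hk, zero_add]
    rw [this, Finset.card_image_of_injective _ (add_left_injective _), Finset.card_range]
  · have : (Finset.range (q * q)).filter (CoordHit q i) =
        (Finset.range q).image fun k => i - q + q * k := by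
      ext g
      simp only [Finset.mem_filter, Finset.mem_range, CoordHit, Finset.mem_image]
      constructor
      · rintro ⟨-, hg, h' | h'⟩
        · have := Nat.div_lt_of_lt_mul hg
          omega
        · refine ⟨g / q, Nat.div_lt_of_lt_mul hg, ?_⟩
          rw [h', Nat.add_sub_cancel_left, Nat.mod_add_div]
      · rintro ⟨k, hk, rfl⟩
        have hlt : i - q + q * k < q * q := by
          have := Nat.mul_le_mul_left q (Nat.succ_le_of_lt hk)
          rw [Nat.mul_succ] at this
          omega
        refine ⟨hlt, hlt, Or.inr ?_⟩
        rw [Nat.add_mul_mod_self_left, Nat.mod_eq_of_lt (by omega)]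
        omega
    rw [this, Finset.card_image_of_injective _ fun a b h => by simpa [hq.ne'] using h,
      Finset.card_range]

/-- The marked positions; the position `4 * i + 1` or `4 * i + 2` has index `i < 2 * q`. -/
def IsMarked (q p : ℕ) : Prop := p < 8 * q ∧ (p % 4 = 1 ∨ p % 4 = 2)

/-- Adjacency of an odd position `x` and an even position `y`: a band on unmarked positions,
a half graph near the marked ones, and a coordinate grid joining marked positions to the
positions from `8 * q` on, the last two even positions being joined to the marked ones of even,
respectively odd, index. -/
def OddEvenAdj (q x y : ℕ) : Prop :=
  x % 2 = 1 ∧ y % 2 = 0 ∧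
    ((¬ IsMarked q x ∧ ¬ IsMarked q y ∧ x ≤ y + 20 * q ∧ y ≤ x + 20 * q) ∨
      ((IsMarked q x ∨ IsMarked q y) ∧ x < 8 * q ∧ y < 8 * q ∧ x ≤ y + 1) ∨
      (IsMarked q x ∧ 8 * q ≤ y ∧ (CoordHit q (x / 4) ((y - 8 * q) / 2) ∨
        q * q ≤ (y - 8 * q) / 2 ∧ (x / 4 + (y - 8 * q) / 2 - q * q) % 2 = 0)) ∨
      (IsMarked q y ∧ 8 * q ≤ x ∧ CoordHit q (y / 4) ((x - 8 * q) / 2)))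

/-- A sparse triangle-free graph on an odd Hamiltonian cycle, bipartite but for one edge. -/
def gridGraph (q : ℕ) : SimpleGraph (Fin (2 * (q * q + 4 * q + 1) + 1)) where
  Adj x y := OddEvenAdj q x y ∨ OddEvenAdj q y x ∨
    (x.val = 0 ∧ y.val = 2 * (q * q + 4 * q + 1)) ∨
    (y.val = 0 ∧ x.val = 2 * (q * q + 4 * q + 1))
  symm := ⟨fun x y h => by tauto⟩
  loopless := ⟨fun x h => by
    rcases h with h | h | h | h
    · exact absurd (h.1.symm.trans h.2.1) one_ne_zero
    · exact absurd (h.1.symm.trans h.2.1) one_ne_zero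
    · omega
    · omega⟩

theorem gridGraph_adj {q : ℕ} {x y : Fin (2 * (q * q + 4 * q + 1) + 1)} :
    (gridGraph q).Adj x y ↔ OddEvenAdj q x y ∨ OddEvenAdj q y x ∨
      (x.val = 0 ∧ y.val = 2 * (q * q + 4 * q + 1)) ∨
      (y.val = 0 ∧ x.val = 2 * (q * q + 4 * q + 1)) := Iff.rfl

theorem oddEvenAdj_of_consecutive {q x y : ℕ} (hq : 1000 ≤ q) (hx : x % 2 = 1)
    (hy : y % 2 = 0) (hxy : x ≤ y + 1) (hyx : y ≤ x + 1) : OddEvenAdj q x y := by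
  refine ⟨hx, hy, ?_⟩
  by_cases h : IsMarked q x ∨ IsMarked q y
  · refine Or.inr (Or.inl ⟨h, ?_, ?_, hxy⟩) <;>
    · unfold IsMarked at h
      omega
  · rw [not_or] at h
    exact Or.inl ⟨h.1, h.2, by omega, by omega⟩

theorem gridGraph_cycle {q : ℕ} (hq : 1000 ≤ q) (x : Fin (2 * (q * q + 4 * q + 1) + 1)) :
    (gridGraph q).Adj x (x + 1) := by
  rw [gridGraph_adj, Fin.val_add_one]
  split_ifs with h
  · rw [h, Fin.val_last]
    simp
  · have hne : x.val ≠ 2 * (q * q + 4 * q + 1) := fun h' => h (Fin.ext h')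
    have hlt := x.isLt
    rcases Nat.mod_two_eq_zero_or_one x.val with hx | hx
    · exact Or.inr (Or.inl (oddEvenAdj_of_consecutive hq (by omega) hx (by omega) (by omega)))
    · exact Or.inl (oddEvenAdj_of_consecutive hq hx (by omega) (by omega) (by omega))

theorem gridGraph_triangle_free {q : ℕ} (hq : 1000 ≤ q)
    (x y z : Fin (2 * (q * q + 4 * q + 1) + 1)) (hxy : (gridGraph q).Adj x y)
    (hyz : (gridGraph q).Adj y z) : ¬ (gridGraph q).Adj x z := by
  intro hxz
  have hqq : 1000 * q ≤ q * q := Nat.mul_le_mul_right q hq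
  have key : ∀ w, OddEvenAdj q w 0 → ¬ OddEvenAdj q w (2 * (q * q + 4 * q + 1)) := by
    intro w h0 h1
    simp only [OddEvenAdj, IsMarked, CoordHit] at h0 h1
    omega
  have hpar : ∀ u w, OddEvenAdj q u w → u % 2 = 1 ∧ w % 2 = 0 := fun u w h => ⟨h.1, h.2.1⟩
  have key' : ∀ u v w : Fin (2 * (q * q + 4 * q + 1) + 1), u.val = 0 →
      v.val = 2 * (q * q + 4 * q + 1) → (gridGraph q).Adj u w → (gridGraph q).Adj v w → False := by
    intro u v w hu hv h1 h2
    rw [gridGraph_adj, hu] at h1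
    rw [gridGraph_adj, hv] at h2
    rcases h1 with h1 | h1 | h1 | h1
    · exact absurd h1.1 (by norm_num)
    · rcases h2 with h2 | h2 | h2 | h2
      · have := h2.1
        omega
      · exact key _ h1 h2
      · omega
      · have := h1.1
        omega
    · rcases h2 with h2 | h2 | h2 | h2
      · have := h2.1
        omega
      · have := h2.1
        omega
      · omega
      · omega
    · omega
  have hcases : ∀ u w : Fin (2 * (q * q + 4 * q + 1) + 1), (gridGraph q).Adj u w →
      u.val % 2 ≠ w.val % 2 ∨ (u.val = 0 ∧ w.val = 2 * (q * q + 4 * q + 1)) ∨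
        (w.val = 0 ∧ u.val = 2 * (q * q + 4 * q + 1)) := by
    intro u w h
    rcases h with h | h | h
    · have := hpar _ _ h
      omega
    · have := hpar _ _ h
      omega
    · exact Or.inr h
  rcases hcases _ _ hxy with h1 | h1 | h1
  · rcases hcases _ _ hyz with h2 | h2 | h2
    · rcases hcases _ _ hxz with h3 | h3 | h3
      · omega
      · exact key' _ _ y h3.1 h3.2 hxy hyz.symm
      · exact key' _ _ y h3.1 h3.2 hyz.symm hxy
    · exact key' _ _ x h2.1 h2.2 hxy.symm hxz.symm
    · exact key' _ _ x h2.1 h2.2 hxz.symm hxy.symm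
  · exact key' _ _ z h1.1 h1.2 hxz hyz
  · exact key' _ _ z h1.1 h1.2 hyz hxz

theorem gridGraph_deg_odd {q i : ℕ} (hi : i < 2 * q)
    (v : Fin (2 * (q * q + 4 * q + 1) + 1)) (hv : v.val = 4 * i + 1) :
    deg (gridGraph q) v + 2 * i = 5 * q + 1 := by
  classical
  rw [deg_eq_card _ v (stepTwo (4 * i) (4 * q - 2 * i) ∪
    (((Finset.range (q * q)).filter (CoordHit q i)).image (fun g => 8 * q + 2 * g) ∪
      {8 * q + 2 * (q * q) + 2 * (i % 2)})), Finset.card_union_of_disjoint,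
    Finset.card_union_of_disjoint, card_stepTwo,
    Finset.card_image_of_injective _ (fun a b h => by simpa using h), card_filter_coordHit hi,
    Finset.card_singleton]
  · omega
  · simp only [Finset.disjoint_singleton_right, Finset.mem_image, Finset.mem_filter,
      Finset.mem_range]
    rintro ⟨g, ⟨hg, -⟩, h⟩
    omega
  · rw [Finset.disjoint_left]
    intro y hy hy'
    simp only [mem_stepTwo, Finset.mem_union, Finset.mem_image, Finset.mem_singleton] at hy hy'
    rcases hy' with ⟨g, -, h⟩ | h <;> omega
  · intro y
    simp only [gridGraph_adj, hv, mem_stepTwo, Finset.mem_union, Finset.mem_image,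
      Finset.mem_singleton, Finset.mem_filter, Finset.mem_range]
    have hdiv : (4 * i + 1) / 4 = i := by omega
    have hm : IsMarked q (4 * i + 1) := ⟨by omega, by omega⟩
    constructor
    · rintro (h | ⟨g, ⟨hg, hc⟩, rfl⟩ | rfl)
      · refine ⟨by omega, Or.inl ⟨by omega, by omega, Or.inr (Or.inl ⟨Or.inl hm, ?_⟩)⟩⟩
        omega
      · refine ⟨by omega, Or.inl ⟨by omega, by omega, Or.inr (Or.inr (Or.inl ⟨hm, by omega, ?_⟩))⟩⟩
        left
        rwa [hdiv, Nat.add_sub_cancel_left, Nat.mul_div_cancel_left _ two_pos]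
      · refine ⟨by omega, Or.inl ⟨by omega, by omega, Or.inr (Or.inr (Or.inl ⟨hm, by omega, ?_⟩))⟩⟩
        omega
    · rintro ⟨hy, h | h | h | h⟩
      · obtain ⟨-, h2, h | h | h | h⟩ := h
        · exact absurd hm h.1
        · left
          omega
        · rw [hdiv] at h
          obtain ⟨-, h3, h | h⟩ := h
          · exact Or.inr (Or.inl ⟨_, ⟨h.1, h⟩, by omega⟩)
          · right
            right
            omega
        · omega
      · have := h.2.1
        omega
      · omega
      · omega

theorem gridGraph_deg_even {q i : ℕ} (hi : i < 2 * q)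
    (v : Fin (2 * (q * q + 4 * q + 1) + 1)) (hv : v.val = 4 * i + 2) :
    deg (gridGraph q) v = 2 * i + 2 + q := by
  classical
  rw [deg_eq_card _ v (stepTwo 1 (2 * i + 2) ∪
    ((Finset.range (q * q)).filter (CoordHit q i)).image (fun g => 8 * q + 1 + 2 * g)),
    Finset.card_union_of_disjoint, card_stepTwo,
    Finset.card_image_of_injective _ (fun a b h => by simpa using h), card_filter_coordHit hi]
  · rw [Finset.disjoint_left]
    intro y hy hy'
    simp only [mem_stepTwo, Finset.mem_image] at hy hy'
    obtain ⟨g, -, h⟩ := hy'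
    omega
  · intro y
    simp only [gridGraph_adj, hv, mem_stepTwo, Finset.mem_union, Finset.mem_image,
      Finset.mem_filter, Finset.mem_range]
    have hdiv : (4 * i + 2) / 4 = i := by omega
    have hm : IsMarked q (4 * i + 2) := ⟨by omega, by omega⟩
    constructor
    · rintro (h | ⟨g, ⟨hg, hc⟩, rfl⟩)
      · refine ⟨by omega, Or.inr (Or.inl ⟨by omega, by omega,
          Or.inr (Or.inl ⟨Or.inr hm, ?_⟩)⟩)⟩
        omega
      · refine ⟨by omega, Or.inr (Or.inl ⟨by omega, by omega,
          Or.inr (Or.inr (Or.inr ⟨hm, by omega, ?_⟩))⟩)⟩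
        rwa [hdiv, add_assoc, Nat.add_sub_cancel_left, Nat.add_mul_div_left _ _ two_pos,
          show 1 / 2 = 0 from rfl, zero_add]
    · rintro ⟨hy, h | h | h | h⟩
      · have := h.1
        omega
      · obtain ⟨h1, -, h | h | h | h⟩ := h
        · exact absurd hm h.2.1
        · left
          omega
        · omega
        · rw [hdiv] at h
          exact Or.inr ⟨_, ⟨h.2.2.1, h.2.2⟩, by omega⟩
      · omega
      · omega

/-- An unmarked vertex is adjacent to each position of a progression of the other parity that
avoids the marked positions and stays within the band. -/
theorem gridGraph_le_deg {q : ℕ} (v : Fin (2 * (q * q + 4 * q + 1) + 1))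
    (hv : ¬ IsMarked q v) (z m : ℕ) (hz : 8 * q ≤ z) (hpar : z % 2 ≠ v.val % 2)
    (hlow : v.val ≤ z + 20 * q) (hup : z + 2 * m ≤ v.val + 20 * q + 2)
    (hn : z + 2 * m ≤ 2 * (q * q + 4 * q + 1) + 2) : m ≤ deg (gridGraph q) v := by
  rw [← card_stepTwo z m]
  refine card_le_deg _ _ _ fun y hy => ?_
  rw [mem_stepTwo] at hy
  refine ⟨by omega, ?_⟩
  have hy' : ¬ IsMarked q y := fun h => by
    have := h.1
    omega
  change OddEvenAdj q v y ∨ OddEvenAdj q y v ∨ _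
  by_cases h : v.val % 2 = 1
  · exact Or.inl ⟨h, by omega, Or.inl ⟨hv, hy', by omega, by omega⟩⟩
  · exact Or.inr (Or.inl ⟨by omega, by omega, Or.inl ⟨hy', hv, by omega, by omega⟩⟩)

theorem gridGraph_lt_deg_of_not_isMarked {q : ℕ} (hq : 1000 ≤ q)
    (v : Fin (2 * (q * q + 4 * q + 1) + 1)) (hv : ¬ IsMarked q v) :
    5 * q + 2 ≤ deg (gridGraph q) v := by
  have hqq : 1000 * q ≤ q * q := Nat.mul_le_mul_right q hq
  have hlt := v.isLt
  by_cases h : v.val + 20 * q < 2 * (q * q + 4 * q + 1)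
  · by_cases h' : v.val < 8 * q
    · exact gridGraph_le_deg v hv (8 * q + (v.val + 1) % 2) _ (by omega) (by omega) (by omega)
        (by omega) (by omega)
    · exact gridGraph_le_deg v hv (v.val + 1) _ (by omega) (by omega) (by omega)
        (by omega) (by omega)
  · exact gridGraph_le_deg v hv (v.val - (10 * q + 5)) _ (by omega) (by omega) (by omega)
        (by omega) (by omega)

theorem gridGraph_deg_of_isMarked {q : ℕ} (v : Fin (2 * (q * q + 4 * q + 1) + 1))
    (hv : IsMarked q v) : deg (gridGraph q) v ≤ 5 * q + 1 := by
  obtain ⟨h1, h2 | h2⟩ := hv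
  · have := gridGraph_deg_odd (i := v.val / 4) (by omega) v (by omega)
    omega
  · have := gridGraph_deg_even (i := v.val / 4) (by omega) v (by omega)
    omega

theorem gridGraph_deg_injOn {q : ℕ} (u v : Fin (2 * (q * q + 4 * q + 1) + 1))
    (hu : IsMarked q u) (hv : IsMarked q v)
    (h : deg (gridGraph q) u = deg (gridGraph q) v) : u = v := by
  obtain ⟨h1, h2⟩ := hu
  obtain ⟨h3, h4⟩ := hv
  apply Fin.ext
  rcases h2 with h2 | h2 <;> rcases h4 with h4 | h4
  · have := gridGraph_deg_odd (i := u.val / 4) (by omega) u (by omega)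
    have := gridGraph_deg_odd (i := v.val / 4) (by omega) v (by omega)
    omega
  · have := gridGraph_deg_odd (i := u.val / 4) (by omega) u (by omega)
    have := gridGraph_deg_even (i := v.val / 4) (by omega) v (by omega)
    omega
  · have := gridGraph_deg_even (i := u.val / 4) (by omega) u (by omega)
    have := gridGraph_deg_odd (i := v.val / 4) (by omega) v (by omega)
    omega
  · have := gridGraph_deg_even (i := u.val / 4) (by omega) u (by omega)
    have := gridGraph_deg_even (i := v.val / 4) (by omega) v (by omega)
    omega

theorem gridGraph_deg_le {q : ℕ} (hq : 1000 ≤ q) (v : Fin (2 * (q * q + 4 * q + 1) + 1)) :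
    deg (gridGraph q) v ≤ 50 * q := by
  by_cases hv : IsMarked q v
  · have := gridGraph_deg_of_isMarked v hv
    omega
  refine (deg_le_card _ v (Finset.Icc (v.val - 20 * q) (v.val + 20 * q) ∪
    (Finset.range (8 * q) ∪ {2 * (q * q + 4 * q + 1)})) fun w hw => ?_).trans ?_
  · simp only [Finset.mem_union, Finset.mem_Icc, Finset.mem_range, Finset.mem_singleton]
    rw [gridGraph_adj] at hw
    rcases hw with ⟨-, -, h | h | h | h⟩ | ⟨-, -, h | h | h | h⟩ | h | h
    · omega
    · omega
    · exact absurd h.1 hv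
    · have := h.1.1
      omega
    · omega
    · omega
    · have := h.1.1
      omega
    · exact absurd h.1 hv
    · omega
    · omega
  · refine (Finset.card_union_le _ _).trans ?_
    have := Finset.card_union_le (Finset.range (8 * q)) {2 * (q * q + 4 * q + 1)}
    rw [Finset.card_range, Finset.card_singleton] at this
    rw [Nat.card_Icc]
    omega

theorem gridGraph_deg_penultimate {q : ℕ} (hq : 1000 ≤ q)
    (v : Fin (2 * (q * q + 4 * q + 1) + 1)) (hv : v.val = 2 * (q * q + 4 * q) + 1) :
    deg (gridGraph q) v ≤ 10 * q + 1 := by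
  have hqq : 1000 * q ≤ q * q := Nat.mul_le_mul_right q hq
  rw [← card_stepTwo (2 * (q * q + 4 * q + 1) - 20 * q) (10 * q + 1)]
  refine deg_le_card _ v _ fun w hw => ?_
  have hlt := w.isLt
  rw [gridGraph_adj, hv] at hw
  rw [mem_stepTwo]
  simp only [OddEvenAdj, IsMarked, CoordHit] at hw
  omega

/-- The three kinds of neighborhoods of unmarked even positions among the marked ones. -/
theorem even_trace {q u : ℕ} (hq : 0 < q) (hu : ¬ IsMarked q u) (heven : u % 2 = 0)
    (hlt : u < 2 * (q * q + 4 * q + 1) + 1) :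
    (∃ k, k < 2 * q ∧ u = 4 * k ∧ ∀ i < 2 * q, (OddEvenAdj q (4 * i + 1) u ↔ i ≤ k)) ∨
    (∃ a b, a < q ∧ b < q ∧ u = 8 * q + 2 * (q * a + b) ∧
      ∀ i < 2 * q, (OddEvenAdj q (4 * i + 1) u ↔ i = a ∨ i = q + b)) ∨
    (∃ e, e < 2 ∧ u = 8 * q + 2 * (q * q + e) ∧
      ∀ i < 2 * q, (OddEvenAdj q (4 * i + 1) u ↔ (i + e) % 2 = 0)) := by
  have hdiv : ∀ i, (4 * i + 1) / 4 = i := fun i => by omega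
  unfold IsMarked at hu
  by_cases h : u < 8 * q
  · refine Or.inl ⟨u / 4, by omega, by omega, fun i hi => ?_⟩
    simp only [OddEvenAdj, IsMarked]
    omega
  · obtain ⟨g, rfl⟩ : ∃ g, u = 8 * q + 2 * g := ⟨(u - 8 * q) / 2, by omega⟩
    have hg : (8 * q + 2 * g - 8 * q) / 2 = g := by omega
    by_cases h' : g < q * q
    · refine Or.inr (Or.inl ⟨g / q, g % q, Nat.div_lt_of_lt_mul h', Nat.mod_lt _ hq,
        by rw [Nat.div_add_mod], fun i hi => ?_⟩)
      simp only [OddEvenAdj, IsMarked, CoordHit, hdiv, hg]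
      omega
    · refine Or.inr (Or.inr ⟨g - q * q, by omega, by omega, fun i hi => ?_⟩)
      simp only [OddEvenAdj, IsMarked, CoordHit, hdiv, hg]
      omega

/-- The three kinds of neighborhoods of unmarked odd positions among the marked ones. -/
theorem odd_trace {q u : ℕ} (hq : 0 < q) (hu : ¬ IsMarked q u) (hodd : u % 2 = 1)
    (hlt : u < 2 * (q * q + 4 * q + 1) + 1) :
    (∃ k, k < 2 * q ∧ u = 4 * k + 3 ∧ ∀ i < 2 * q, (OddEvenAdj q u (4 * i + 2) ↔ k ≤ i)) ∨
    (∃ a b, a < q ∧ b < q ∧ u = 8 * q + 1 + 2 * (q * a + b) ∧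
      ∀ i < 2 * q, (OddEvenAdj q u (4 * i + 2) ↔ i = a ∨ i = q + b)) ∨
    (u = 8 * q + 1 + 2 * (q * q) ∧ ∀ i < 2 * q, ¬ OddEvenAdj q u (4 * i + 2)) := by
  have hdiv : ∀ i, (4 * i + 2) / 4 = i := fun i => by omega
  unfold IsMarked at hu
  by_cases h : u < 8 * q
  · refine Or.inl ⟨u / 4, by omega, by omega, fun i hi => ?_⟩
    simp only [OddEvenAdj, IsMarked]
    omega
  · obtain ⟨g, rfl⟩ : ∃ g, u = 8 * q + 1 + 2 * g := ⟨(u - 8 * q) / 2, by omega⟩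
    have hg : (8 * q + 1 + 2 * g - 8 * q) / 2 = g := by omega
    by_cases h' : g < q * q
    · refine Or.inr (Or.inl ⟨g / q, g % q, Nat.div_lt_of_lt_mul h', Nat.mod_lt _ hq,
        by rw [Nat.div_add_mod], fun i hi => ?_⟩)
      simp only [OddEvenAdj, IsMarked, CoordHit, hdiv, hg]
      omega
    · refine Or.inr (Or.inr ⟨by omega, fun i hi => ?_⟩)
      simp only [OddEvenAdj, IsMarked, CoordHit, hdiv, hg]
      omega

theorem even_eq_of_trace_eq {q u v : ℕ} (hq : 1000 ≤ q) (hu : ¬ IsMarked q u)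
    (hv : ¬ IsMarked q v) (hun : u < 2 * (q * q + 4 * q + 1) + 1)
    (hvn : v < 2 * (q * q + 4 * q + 1) + 1) (hpu : u % 2 = 0) (hpv : v % 2 = 0)
    (h : ∀ i < 2 * q, OddEvenAdj q (4 * i + 1) u ↔ OddEvenAdj q (4 * i + 1) v) : u = v := by
  rcases even_trace (by omega) hu hpu hun with
      ⟨k, hk, rfl, H⟩ | ⟨a, b, ha, hb, rfl, H⟩ | ⟨e, he, rfl, H⟩ <;>
    rcases even_trace (by omega) hv hpv hvn with
      ⟨k', hk', rfl, H'⟩ | ⟨a', b', ha', hb', rfl, H'⟩ | ⟨e', he', rfl, H'⟩ <;>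
    replace h : ∀ i < 2 * q, (_ ↔ _) :=
      fun i hi => (H i hi).symm.trans ((h i hi).trans (H' i hi)) <;>
    clear H H' hu hv hun hvn hpu hpv
  · have := h k hk
    have := h k' hk'
    omega
  · have := h 0 (by omega)
    have := h 1 (by omega)
    have := h (q + b') (by omega)
    omega
  · have := h 0 (by omega)
    have := h 1 (by omega)
    have := h 2 (by omega)
    omega
  · have := h 0 (by omega)
    have := h 1 (by omega)
    have := h (q + b) (by omega)
    omega
  · have := h a (by omega)
    have := h (q + b) (by omega)
    obtain rfl : a = a' := by omega
    obtain rfl : b = b' := by omega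
    rfl
  · have := h 0 (by omega)
    have := h 1 (by omega)
    have := h 2 (by omega)
    have := h 3 (by omega)
    omega
  · have := h 0 (by omega)
    have := h 1 (by omega)
    have := h 2 (by omega)
    omega
  · have := h 0 (by omega)
    have := h 1 (by omega)
    have := h 2 (by omega)
    have := h 3 (by omega)
    omega
  · have := h 0 (by omega)
    omega

theorem odd_eq_of_trace_eq {q u v : ℕ} (hq : 1000 ≤ q) (hu : ¬ IsMarked q u)
    (hv : ¬ IsMarked q v) (hun : u < 2 * (q * q + 4 * q + 1) + 1)
    (hvn : v < 2 * (q * q + 4 * q + 1) + 1) (hpu : u % 2 = 1) (hpv : v % 2 = 1)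
    (h : ∀ i < 2 * q, OddEvenAdj q u (4 * i + 2) ↔ OddEvenAdj q v (4 * i + 2)) : u = v := by
  rcases odd_trace (by omega) hu hpu hun with
      ⟨k, hk, rfl, H⟩ | ⟨a, b, ha, hb, rfl, H⟩ | ⟨rfl, H⟩ <;>
    rcases odd_trace (by omega) hv hpv hvn with
      ⟨k', hk', rfl, H'⟩ | ⟨a', b', ha', hb', rfl, H'⟩ | ⟨rfl, H'⟩
  · have := (H k hk).symm.trans ((h k hk).trans (H' k hk))
    have := (H k' hk').symm.trans ((h k' hk').trans (H' k' hk'))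
    omega
  · have h1 : 2 * q - 1 < 2 * q := by omega
    have h2 : 2 * q - 2 < 2 * q := by omega
    have h3 : a' < 2 * q := by omega
    have := (H _ h1).symm.trans ((h _ h1).trans (H' _ h1))
    have := (H _ h2).symm.trans ((h _ h2).trans (H' _ h2))
    have := (H _ h3).symm.trans ((h _ h3).trans (H' _ h3))
    omega
  · exact absurd ((h k hk).1 ((H k hk).2 le_rfl)) (H' k hk)
  · have h1 : 2 * q - 1 < 2 * q := by omega
    have h2 : 2 * q - 2 < 2 * q := by omega
    have h3 : a < 2 * q := by omega
    have := (H _ h1).symm.trans ((h _ h1).trans (H' _ h1))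
    have := (H _ h2).symm.trans ((h _ h2).trans (H' _ h2))
    have := (H _ h3).symm.trans ((h _ h3).trans (H' _ h3))
    omega
  · have h1 : a < 2 * q := by omega
    have h2 : q + b < 2 * q := by omega
    have := (H _ h1).symm.trans ((h _ h1).trans (H' _ h1))
    have := (H _ h2).symm.trans ((h _ h2).trans (H' _ h2))
    obtain rfl : a = a' := by omega
    obtain rfl : b = b' := by omega
    rfl
  · have h1 : a < 2 * q := by omega
    exact absurd ((h a h1).1 ((H a h1).2 (Or.inl rfl))) (H' a h1)
  · exact absurd ((h k' hk').2 ((H' k' hk').2 le_rfl)) (H k' hk')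
  · have h1 : a' < 2 * q := by omega
    exact absurd ((h a' h1).2 ((H' a' h1).2 (Or.inl rfl))) (H a' h1)
  · rfl

theorem exists_oddEvenAdj_of_even {q u : ℕ} (hq : 1000 ≤ q) (hu : ¬ IsMarked q u)
    (heven : u % 2 = 0) (hlt : u < 2 * (q * q + 4 * q + 1) + 1) :
    ∃ i < 2 * q, OddEvenAdj q (4 * i + 1) u := by
  rcases even_trace (by omega) hu heven hlt with
      ⟨k, hk, rfl, H⟩ | ⟨a, b, ha, hb, rfl, H⟩ | ⟨e, he, rfl, H⟩
  · exact ⟨k, hk, (H k hk).2 le_rfl⟩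
  · exact ⟨a, by omega, (H a (by omega)).2 (Or.inl rfl)⟩
  · exact ⟨e, by omega, (H e (by omega)).2 (by omega)⟩

theorem eq_of_trace_eq {q u v : ℕ} (hq : 1000 ≤ q) (hu : ¬ IsMarked q u)
    (hv : ¬ IsMarked q v) (hun : u < 2 * (q * q + 4 * q + 1) + 1)
    (hvn : v < 2 * (q * q + 4 * q + 1) + 1)
    (hodd : ∀ i < 2 * q, OddEvenAdj q (4 * i + 1) u ↔ OddEvenAdj q (4 * i + 1) v)
    (heven : ∀ i < 2 * q, OddEvenAdj q u (4 * i + 2) ↔ OddEvenAdj q v (4 * i + 2)) : u = v := by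
  rcases Nat.mod_two_eq_zero_or_one u with hpu | hpu <;>
    rcases Nat.mod_two_eq_zero_or_one v with hpv | hpv
  · exact even_eq_of_trace_eq hq hu hv hun hvn hpu hpv hodd
  · obtain ⟨i, hi, h⟩ := exists_oddEvenAdj_of_even hq hu hpu hun
    have := ((hodd i hi).1 h).2.1
    omega
  · obtain ⟨i, hi, h⟩ := exists_oddEvenAdj_of_even hq hv hpv hvn
    have := ((hodd i hi).2 h).2.1
    omega
  · exact odd_eq_of_trace_eq hq hu hv hun hvn hpu hpv heven

theorem gridGraph_separates {q : ℕ} (hq : 1000 ≤ q)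
    (u v : Fin (2 * (q * q + 4 * q + 1) + 1)) (hu : ¬ IsMarked q u) (hv : ¬ IsMarked q v)
    (h : ∀ s : Fin (2 * (q * q + 4 * q + 1) + 1), IsMarked q s →
      ((gridGraph q).Adj u s ↔ (gridGraph q).Adj v s)) : u = v := by
  have hodd : ∀ (w : Fin (2 * (q * q + 4 * q + 1) + 1)) (i : ℕ) (hi : i < 2 * q),
      (gridGraph q).Adj w ⟨4 * i + 1, by omega⟩ ↔ OddEvenAdj q (4 * i + 1) w := by
    intro w i hi
    rw [gridGraph_adj]
    refine ⟨?_, fun h => Or.inr (Or.inl h)⟩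
    rintro (h | h | h | h)
    · have : (4 * i + 1) % 2 = 0 := h.2.1
      omega
    · exact h
    · have : 4 * i + 1 = _ := h.2
      omega
    · have : 4 * i + 1 = _ := h.1
      omega
  have heven : ∀ (w : Fin (2 * (q * q + 4 * q + 1) + 1)) (i : ℕ) (hi : i < 2 * q),
      (gridGraph q).Adj w ⟨4 * i + 2, by omega⟩ ↔ OddEvenAdj q w (4 * i + 2) := by
    intro w i hi
    have hqq : 1000 * q ≤ q * q := Nat.mul_le_mul_right q hq
    rw [gridGraph_adj]
    refine ⟨?_, fun h => Or.inl h⟩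
    rintro (h | h | h | h)
    · exact h
    · have : (4 * i + 2) % 2 = 1 := h.1
      omega
    · have : 4 * i + 2 = _ := h.2
      omega
    · have : 4 * i + 2 = _ := h.1
      omega
  refine Fin.ext (eq_of_trace_eq hq hu hv u.isLt v.isLt (fun i hi => ?_) fun i hi => ?_)
  · rw [← hodd u i hi, ← hodd v i hi]
    exact h _ ⟨by dsimp only; omega, by dsimp only; omega⟩
  · rw [← heven u i hi, ← heven v i hi]
    exact h _ ⟨by dsimp only; omega, by dsimp only; omega⟩


theorem exists_roots {q : ℕ} (hq : 1000 ≤ q) : ∃ a b : Fin (2 * (q * q + 4 * q + 1) + 1),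
    ¬ IsMarked q a ∧ ¬ IsMarked q b ∧ (gridGraph q)ᶜ.Adj a b ∧
      deg (gridGraph q)ᶜ a < deg (gridGraph q)ᶜ b := by
  have hqq : 1000 * q ≤ q * q := Nat.mul_le_mul_right q hq
  obtain ⟨a, ha⟩ : ∃ a : Fin (2 * (q * q + 4 * q + 1) + 1), a.val = 30 * q + 1 :=
    ⟨⟨30 * q + 1, by omega⟩, rfl⟩
  obtain ⟨b, hb⟩ : ∃ b : Fin (2 * (q * q + 4 * q + 1) + 1), b.val = 2 * (q * q + 4 * q) + 1 :=
    ⟨⟨2 * (q * q + 4 * q) + 1, by omega⟩, rfl⟩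
  have hma : ¬ IsMarked q a := fun h => by
    have := h.1
    omega
  have hmb : ¬ IsMarked q b := fun h => by
    have := h.1
    omega
  refine ⟨a, b, hma, hmb, ?_, ?_⟩
  · rw [SimpleGraph.compl_adj, gridGraph_adj, ha, hb]
    refine ⟨fun h => ?_, ?_⟩
    · have := congrArg Fin.val h
      omega
    · simp only [OddEvenAdj]
      omega
  · have h1 := gridGraph_deg_penultimate hq b hb
    have h2 := gridGraph_le_deg a hma (10 * q + 2) (20 * q) (by omega) (by omega) (by omega)
      (by omega) (by omega)
    have h3 := deg_compl_add_deg (gridGraph q) a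
    have h4 := deg_compl_add_deg (gridGraph q) b
    omega

theorem compl_gridGraph_marked_lt {q : ℕ} (hq : 1000 ≤ q)
    (u : Fin (2 * (q * q + 4 * q + 1) + 1)) (hu : IsMarked q u)
    (v : Fin (2 * (q * q + 4 * q + 1) + 1)) (hv : ¬ IsMarked q v) :
    deg (gridGraph q)ᶜ v < deg (gridGraph q)ᶜ u := by
  have h1 := gridGraph_deg_of_isMarked u hu
  have h2 := gridGraph_lt_deg_of_not_isMarked hq v hv
  have h3 := deg_compl_add_deg (gridGraph q) u
  have h4 := deg_compl_add_deg (gridGraph q) v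
  omega

theorem compl_gridGraph_deg_ne {q : ℕ} (u : Fin (2 * (q * q + 4 * q + 1) + 1))
    (hu : IsMarked q u) (v : Fin (2 * (q * q + 4 * q + 1) + 1)) (hv : IsMarked q v)
    (hne : u ≠ v) :
    deg (gridGraph q)ᶜ u ≠ deg (gridGraph q)ᶜ v := by
  intro h
  have h3 := deg_compl_add_deg (gridGraph q) u
  have h4 := deg_compl_add_deg (gridGraph q) v
  exact hne (gridGraph_deg_injOn u v hu hv (by omega))

theorem compl_gridGraph_separates {q : ℕ} (hq : 1000 ≤ q)
    (u v : Fin (2 * (q * q + 4 * q + 1) + 1)) (hu : ¬ IsMarked q u) (hv : ¬ IsMarked q v)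
    (hne : u ≠ v) :
    (gridGraph q)ᶜ.neighborSet u ∩ {s | IsMarked q s} ≠
      (gridGraph q)ᶜ.neighborSet v ∩ {s | IsMarked q s} := by
  intro h
  refine hne (gridGraph_separates hq u v hu hv fun s hs => ?_)
  have hs' := Set.ext_iff.1 h s
  simp only [Set.mem_inter_iff, SimpleGraph.mem_neighborSet, Set.mem_ofPred_eq, hs, and_true,
    SimpleGraph.compl_adj] at hs'
  have h1 : u ≠ s := fun h => hu (h ▸ hs)
  have h2 : v ≠ s := fun h => hv (h ▸ hs)
  simpa only [h1, h2, ne_eq, not_false_eq_true, true_and, not_iff_not] using hs'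

theorem compl_gridGraph_rigid {q : ℕ} (hq : 1000 ≤ q) : Rigid (gridGraph q)ᶜ :=
  rigid_of_separating _
    (surjective_of_compl_hom _ (gridGraph_cycle hq) (gridGraph_triangle_free hq)) {s | IsMarked q s}
    (compl_gridGraph_marked_lt hq) compl_gridGraph_deg_ne (compl_gridGraph_separates hq)

theorem compl_gridGraph_deg_near {r ℓ : ℕ} (hr : 1000 ≤ r) (i : Fin ℓ)
    (v : Fin (2 * ((r * 3 ^ i.val) * (r * 3 ^ i.val) + 4 * (r * 3 ^ i.val) + 1) + 1)) :
    deg (gridGraph (r * 3 ^ i.val))ᶜ v ≤ 9 ^ i.val * (2 * (r * r)) + 50 * (r * 3 ^ ℓ) ∧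
      9 ^ i.val * (2 * (r * r)) ≤ deg (gridGraph (r * 3 ^ i.val))ᶜ v + 50 * (r * 3 ^ ℓ) := by
  have hq : 1000 ≤ r * 3 ^ i.val := hr.trans (Nat.le_mul_of_pos_right _ (by positivity))
  have h1 := gridGraph_deg_le hq v
  have h2 := deg_compl_add_deg (gridGraph (r * 3 ^ i.val)) v
  have h3 : r * 3 ^ i.val ≤ r * 3 ^ ℓ :=
    Nat.mul_le_mul_left r (Nat.pow_le_pow_right (by norm_num) i.isLt.le)
  have h4 : (r * 3 ^ i.val) * (r * 3 ^ i.val) * 2 = 9 ^ i.val * (2 * (r * r)) := by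
    rw [show (9 : ℕ) = 3 * 3 from rfl, mul_pow]
    ring
  omega

/-- There exists a family of edge-rooted rigid graphs with pairwise distinguishable
degrees and neighborhood structures. -/
theorem exists_rigid_family (ℓ n₀ : ℕ) :
    ∃ (n : Fin ℓ → ℕ) (F : ∀ i : Fin ℓ, SimpleGraph (Fin (n i)))
      (a b : ∀ i : Fin ℓ, Fin (n i)),
      (∀ i, n₀ ≤ n i) ∧
      (∀ i, (F i).Adj (a i) (b i)) ∧
      -- (1) each `F i` is rigid
      (∀ i, Rigid (F i)) ∧
      -- (2) every two distinct vertices have a triangle in their common neighborhood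
      (∀ i, ∀ u v : Fin (n i), u ≠ v →
        ∃ x y z : Fin (n i),
          (F i).Adj u x ∧ (F i).Adj v x ∧ (F i).Adj u y ∧ (F i).Adj v y ∧
          (F i).Adj u z ∧ (F i).Adj v z ∧
          (F i).Adj x y ∧ (F i).Adj x z ∧ (F i).Adj y z) ∧
      -- (3) `N(a i) \ N(b i)` and `N(b i) \ N(a i)` are both nonempty
      (∀ i, (∃ w, (F i).Adj (a i) w ∧ ¬ (F i).Adj (b i) w) ∧
            (∃ w, (F i).Adj (b i) w ∧ ¬ (F i).Adj (a i) w)) ∧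
      -- (4) `d(a i) < d(b i)`
      (∀ i, deg (F i) (a i) < deg (F i) (b i)) ∧
      -- (5) degrees in `F i` are strictly smaller than degrees in `F j` for `i < j`
      (∀ i j : Fin ℓ, i < j → ∀ (u : Fin (n i)) (v : Fin (n j)),
        deg (F i) u < deg (F j) v) ∧
      -- (6) distinct unordered pairs give disjoint degree-sum sets
      (∀ i j i' j' : Fin ℓ, ({i, j} : Finset (Fin ℓ)) ≠ ({i', j'} : Finset (Fin ℓ)) →
        Disjoint (DegSumSet (F i) (F j)) (DegSumSet (F i') (F j'))) ∧
      -- (7) degree-sum sets are disjoint from the set of single degrees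
      Disjoint (⋃ i : Fin ℓ, ⋃ j : Fin ℓ, DegSumSet (F i) (F j))
        {d | ∃ t : Fin ℓ, ∃ w : Fin (n t), d = deg (F t) w} ∧
      -- (8) a distinguished set `S i` of high-degree vertices with distinct degrees,
      -- whose traces on neighborhoods separate the remaining vertices
      (∀ i, ∃ S : Set (Fin (n i)),
        a i ∉ S ∧ b i ∉ S ∧
        (∀ u ∈ S, ∀ v ∉ S, deg (F i) v < deg (F i) u) ∧
        (∀ u ∈ S, ∀ v ∈ S, u ≠ v → deg (F i) u ≠ deg (F i) v) ∧
        (∀ u v : Fin (n i), u ∉ S → v ∉ S → u ≠ v →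
          (F i).neighborSet u ∩ S ≠ (F i).neighborSet v ∩ S)) := by
  classical
  obtain ⟨r, hr⟩ : ∃ r, r = 1000 * 3 ^ ℓ + n₀ := ⟨_, rfl⟩
  have hpow : 1 ≤ 3 ^ ℓ := Nat.one_le_pow _ _ (by norm_num)
  have hr1000 : 1000 ≤ r := by omega
  have hq : ∀ i : Fin ℓ, 1000 ≤ r * 3 ^ i.val := fun i =>
    hr1000.trans (Nat.le_mul_of_pos_right _ (by positivity))
  have hqr : ∀ i : Fin ℓ, r ≤ r * 3 ^ i.val := fun i => Nat.le_mul_of_pos_right _ (by positivity)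
  have hD : 8 * (50 * (r * 3 ^ ℓ)) < 2 * (r * r) := by
    have : r * (1000 * 3 ^ ℓ) ≤ r * r := Nat.mul_le_mul_left r (by omega)
    have h' : 0 < r * 3 ^ ℓ := by positivity
    rw [mul_left_comm] at this
    omega
  have hnear := fun i : Fin ℓ => compl_gridGraph_deg_near (ℓ := ℓ) hr1000 i
  choose a b hma hmb hab hdeg using fun i : Fin ℓ => exists_roots (hq i)
  refine ⟨_, fun i => (gridGraph (r * 3 ^ i.val))ᶜ, a, b, fun i => ?_, hab,
    fun i => compl_gridGraph_rigid (hq i), fun i u v _ => ?_,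
    fun i => ⟨⟨b i, hab i, SimpleGraph.irrefl _⟩, ⟨a i, (hab i).symm, SimpleGraph.irrefl _⟩⟩,
    hdeg, fun i j hij u v => ?_, fun i j i' j' hne => ?_, ?_, fun i => ?_⟩
  · have := hqr i
    omega
  · refine exists_common_triangle _ (gridGraph_deg_le (hq i)) ?_ u v
    have := hq i
    have := Nat.mul_le_mul_right (r * 3 ^ i.val) this
    omega
  · have h1 := hnear i u
    have h2 := hnear j v
    have h3 : 9 ^ i.val < 9 ^ j.val := Nat.pow_lt_pow_right (by norm_num) hij
    have h4 := Nat.mul_le_mul_right (2 * (r * r)) (Nat.succ_le_of_lt h3)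
    rw [Nat.succ_mul] at h4
    dsimp only
    omega
  · rw [Set.disjoint_left]
    intro x hx hx'
    obtain ⟨c, d, hc, hd, h1, h2⟩ := exists_near_of_mem_degSumSet (hnear i) (hnear j) hx
    obtain ⟨c', d', hc', hd', h1', h2'⟩ := exists_near_of_mem_degSumSet (hnear i') (hnear j') hx'
    have h := pow_sum_support hc hd hc' hd' (eq_of_mul_near hD h1 h2 h1' h2')
    refine hne (Finset.ext fun k => ?_)
    simpa only [Finset.mem_insert, Finset.mem_singleton, Fin.ext_iff] using h k.val
  · rw [Set.disjoint_left]
    intro x hx hx'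
    simp only [Set.mem_iUnion] at hx
    obtain ⟨i, j, hx⟩ := hx
    obtain ⟨t, w, rfl⟩ := hx'
    obtain ⟨c, d, hc, hd, h1, h2⟩ := exists_near_of_mem_degSumSet (hnear i) (hnear j) hx
    have h3 := hnear t w
    exact pow_sum_ne_pow hc hd (eq_of_mul_near hD h1 h2
      (h3.1.trans (by omega)) (h3.2.trans (by dsimp only; omega)))
  · exact ⟨{s | IsMarked (r * 3 ^ i.val) s}, hma i, hmb i, compl_gridGraph_marked_lt (hq i),
      compl_gridGraph_deg_ne, compl_gridGraph_separates (hq i)⟩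
end

section
/- Let n ≥ 1, let A be a set, and let c : ℤ/nℤ → 𝔽₃ × A with c̄(s) := (−(c(s))₁, (c(s))₂). Suppose there exist i, j ∈ ℤ/nℤ with i ≠ j such that for every s ∈ ℤ/nℤ at least one of the following holds: (a) c(i+s−1) = c(j+s−1) and c(i+s) = c(j+s), or (b) c(i+s−1) = c̄(j+s) and c(i+s) = c̄(j+s−1). Then either (1) c(x + (j−i)) = c(x) for all x ∈ ℤ/nℤ, or (2) c(x+2) = c(x) for all x ∈ ℤ/nℤ and the first coordinate of c(x) is 0 for all x ∈ ℤ/nℤ. -/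
/-- Rotational symmetry of an edge-colored oriented cycle
(Proposition on cycle rotation): an edge-colored oriented cycle of order `n` is
encoded by `c : ZMod n → ZMod 3 × A`, where `c s` is the directed color of the edge
`e_s = {v_s, v_{s+1}}`, the first coordinate recording the orientation; the reversed
directed color is `c̄ s = (-(c s).1, (c s).2)`. If there are `i ≠ j` such that for
every `s` either `c (i+s-1) = c (j+s-1)` and `c (i+s) = c (j+s)`, or
`c (i+s-1) = c̄ (j+s)` and `c (i+s) = c̄ (j+s-1)`, then either rotation by `j - i`
preserves the coloring, or rotation by `2` preserves the coloring and every edge has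
orientation `0`. -/
theorem cycle_rotation {n : ℕ} (hn : 1 ≤ n) {A : Type}
    (c : ZMod n → ZMod 3 × A) (i j : ZMod n) (hij : i ≠ j)
    (h : ∀ s : ZMod n,
      (c (i + s - 1) = c (j + s - 1) ∧ c (i + s) = c (j + s)) ∨
      (c (i + s - 1) = (-(c (j + s)).1, (c (j + s)).2) ∧
        c (i + s) = (-(c (j + s - 1)).1, (c (j + s - 1)).2))) :
    (∀ x : ZMod n, c (x + (j - i)) = c x) ∨
    ((∀ x : ZMod n, c (x + 2) = c x) ∧ ∀ x : ZMod n, (c x).1 = 0) := by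
  have : NeZero n := ⟨by omega⟩
  by_cases hc : ∀ x : ZMod n, c (x + (j - i)) = c x
  · exact Or.inl hc
  right
  push Not at hc
  obtain ⟨x₀, hx₀⟩ := hc
  set d := j - i with hd
  let r : ZMod 3 × A → ZMod 3 × A := fun p => (-p.1, p.2)
  have hr : ∀ p, r (r p) = p := fun p => by simp [r]
  have hxd : ∀ x, (c (x - 1) = c (x + d - 1) ∧ c x = c (x + d)) ∨
      (c (x - 1) = r (c (x + d)) ∧ c x = r (c (x + d - 1))) := fun x => by
    have h' := h (x - i)
    rwa [show i + (x - i) = x by ring, show j + (x - i) = x + d by rw [hd]; ring] at h'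
  have twist : ∀ x, c (x + d) ≠ c x →
      c (x - 1) = r (c (x + d)) ∧ c x = r (c (x + d - 1)) := fun x hx =>
    (hxd x).resolve_left fun H => hx H.2.symm
  have twist_succ : ∀ x, c (x + d) ≠ c x →
      c x = r (c (x + 1 + d)) ∧ c (x + 1) = r (c (x + d)) := fun x hx => by
    have h' := hxd (x + 1)
    rw [show x + 1 - 1 = x by ring, show x + 1 + d - 1 = x + d by ring] at h'
    exact h'.resolve_left fun H => hx H.1.symm
  have ne_succ : ∀ x, c (x + d) ≠ c x → c (x + 1 + d) ≠ c (x + 1) := fun x hx he => by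
    obtain ⟨h₁, h₂⟩ := twist_succ x hx
    rw [he, h₂, hr] at h₁
    exact hx h₁.symm
  have ne_add : ∀ m : ℕ, c (x₀ + m + d) ≠ c (x₀ + m) := fun m => by
    induction m with
    | zero => simpa using hx₀
    | succ m ih => simpa [add_assoc] using ne_succ _ ih
  have ne_all : ∀ x, c (x + d) ≠ c x := fun x => by
    obtain ⟨m, hm⟩ := ZMod.natCast_zmod_surjective (x - x₀)
    simpa [hm] using ne_add m
  have per : ∀ x, c (x + 2) = c x := fun x => by
    have h₁ := (twist (x + 1) (ne_all _)).1
    have h₂ := (twist_succ (x + 1) (ne_all _)).2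
    rw [show x + 1 - 1 = x by ring] at h₁
    rw [show x + 1 + 1 = x + 2 by ring] at h₂
    rw [h₁, h₂]
  have per_mul : ∀ (m : ℕ) x, c (x + 2 * m) = c x := fun m => by
    induction m with
    | zero => simp
    | succ m ih =>
      intro x
      rw [← ih x, ← per (x + 2 * m)]
      congr 1
      push_cast
      ring
  refine ⟨per, fun x => ?_⟩
  obtain ⟨m, hm⟩ := ZMod.natCast_zmod_surjective d
  obtain ⟨k, hk | hk⟩ := m.even_or_odd'
  · refine absurd ?_ (ne_all x)
    rw [← hm, hk, Nat.cast_mul, Nat.cast_ofNat, per_mul]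
  · have h₁ := (twist_succ (x - 1) (ne_all _)).2
    rw [← hm, hk, show x - 1 + ((2 * k + 1 : ℕ) : ZMod n) = x + 2 * k by push_cast; ring,
      per_mul, sub_add_cancel] at h₁
    have neg_self : ∀ a : ZMod 3, a = -a → a = 0 := by decide
    exact neg_self _ (congrArg Prod.fst h₁)
end

section
/- Let n ≥ 1, let A be a set, and let c : ℤ/nℤ → 𝔽₃ × A with c̄(s) := (−(c(s))₁, (c(s))₂). Suppose there exists i ∈ ℤ/nℤ such that for every s ∈ ℤ/nℤ at least one of the following holds: (a) c(s−1) = c(i−s−1) and c(s) = c(i−s), or (b) c(s−1) = c̄(i−s) and c(s) = c̄(i−s−1). If there do not exist values c₀, c₁ ∈ 𝔽₃ × A such that c(2x) = c₀ and c(2x+1) = c₁ for all x ∈ ℤ/nℤ, then c(i−x−1) = c̄(x) for all x ∈ ℤ/nℤ. -/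
/-- Induction around the cycle `ZMod n`, starting from an arbitrary point. -/
theorem ZMod.forall_of_forall_add_one {n : ℕ} [NeZero n] {P : ZMod n → Prop} {a : ZMod n}
    (ha : P a) (hstep : ∀ x, P x → P (x + 1)) (x : ZMod n) : P x := by
  have key : ∀ k : ℕ, P (a + k) := by
    intro k
    induction k with
    | zero => simpa using ha
    | succ k ih => simpa [add_assoc] using hstep _ ih
  simpa using key (x - a).val


/-- Reflective symmetry of an edge-colored oriented cycle
(Proposition on cycle reflection): an edge-colored oriented cycle of order `n` is
encoded by `c : ZMod n → ZMod 3 × A`, where `c s` is the directed color of the edge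
`e_s = {v_s, v_{s+1}}`, the first coordinate recording the orientation; the reversed
directed color is `c̄ s = (-(c s).1, (c s).2)`. Suppose there is an `i` such that for
every `s` either `c (s-1) = c (i-s-1)` and `c s = c (i-s)`, or `c (s-1) = c̄ (i-s)`
and `c s = c̄ (i-s-1)`. If the coloring is not alternating between two fixed directed
colors on even and odd positions, then `c (i-x-1) = c̄ x` for all `x`, i.e. the
reflection `v_x ↦ v_{i-x}` is a color respecting automorphism of the cycle. -/
theorem cycle_reflection {n : ℕ} (hn : 1 ≤ n) {A : Type}
    (c : ZMod n → ZMod 3 × A) (i : ZMod n)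
    (h : ∀ s : ZMod n,
      (c (s - 1) = c (i - s - 1) ∧ c s = c (i - s)) ∨
      (c (s - 1) = (-(c (i - s)).1, (c (i - s)).2) ∧
        c s = (-(c (i - s - 1)).1, (c (i - s - 1)).2)))
    (hno : ¬ ∃ c₀ c₁ : ZMod 3 × A, ∀ x : ZMod n,
      c (2 * x) = c₀ ∧ c (2 * x + 1) = c₁) :
    ∀ x : ZMod n, c (i - x - 1) = (-(c x).1, (c x).2) := by
  have : NeZero n := ⟨by omega⟩
  by_contra hfail
  push Not at hfail
  obtain ⟨x₀, hx₀⟩ := hfail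
  have step : ∀ x, c (i - x - 1) ≠ (-(c x).1, (c x).2) →
      c (x + 1) = c (x - 1) ∧
        c (i - (x + 1) - 1) ≠ (-(c (x + 1)).1, (c (x + 1)).2) := by
    intro x hx
    have hx' : c x ≠ (-(c (i - x - 1)).1, (c (i - x - 1)).2) :=
      fun e => hx (by rw [e, neg_neg])
    have h₀ := (h x).resolve_right fun e => hx' e.2
    have h₁ := h (x + 1)
    rw [add_sub_cancel_right, show i - (x + 1) = i - x - 1 by ring] at h₁
    replace h₁ := h₁.resolve_right fun e => hx' e.1
    refine ⟨h₁.2.trans h₀.1.symm, ?_⟩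
    rwa [show i - (x + 1) - 1 = i - x - 1 - 1 by ring, ← h₁.1, h₁.2]
  have hall := ZMod.forall_of_forall_add_one
    (P := fun x => c (i - x - 1) ≠ (-(c x).1, (c x).2)) hx₀ fun x hx => (step x hx).2
  have period : ∀ x, c (x + 2) = c x := fun x => by
    have e := (step (x + 1) (hall (x + 1))).1
    rwa [add_sub_cancel_right, show x + 1 + 1 = x + 2 by ring] at e
  refine hno ⟨c 0, c 1, fun x => ?_⟩
  refine ZMod.forall_of_forall_add_one
    (P := fun x => c (2 * x) = c 0 ∧ c (2 * x + 1) = c 1) (a := 0) (by simp) ?_ x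
  rintro y ⟨h₀, h₁⟩
  constructor
  · rw [show 2 * (y + 1) = 2 * y + 2 by ring, period, h₀]
  · rw [show 2 * (y + 1) + 1 = 2 * y + 1 + 2 by ring, period, h₁]
end
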